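/- arXiv:1108.5603 — 3 statements merged into one kernel-verified Lean document; each statement's English description precedes it below -/
import Mathlib

section
/- Let n and N be positive integers with N ≤ 2^n, let s be an integer with 2 ≤ s ≤ 2^(n−1), and let r be the unique integer with ∑_{k=r+1}^n C(n,k) ≤ N < ∑_{k=r}^n C(n,k); assume r < n/2. Suppose 𝓐 is a family of subsets of [n] with |𝓐| = N such that [n]^(≥r+1) ⊆ 𝓐 and 𝓐 contains a set of size strictly less than r. Then there exists a family 𝓐' of subsets of [n] with |𝓐'| = N and |𝕀^(s)(𝓐')| > |𝕀^(s)(𝓐)|. -/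
open Finset

/-- The ground set `[n] = {1, …, n}`. -/
def groundSet (n : ℕ) : Finset ℕ := Finset.Icc 1 n

/-- All subsets of `[n]`. -/
def allFams (n : ℕ) : Finset (Finset ℕ) := (groundSet n).powerset

/-- `[n]^(≥ r)`: subsets of `[n]` of size at least `r`. -/
def layerGE (n r : ℕ) : Finset (Finset ℕ) := (allFams n).filter fun A => r ≤ A.card

/-- `[n]^(r)`: subsets of `[n]` of size exactly `r`. -/
def layerEQ (n r : ℕ) : Finset (Finset ℕ) := (groundSet n).powersetCard r

/-- `𝕀^(s)(𝓐)`: the intersecting subfamilies of `𝓐` of size `s`. -/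
def interFams (s : ℕ) (𝓐 : Finset (Finset ℕ)) : Finset (Finset (Finset ℕ)) :=
  (𝓐.powersetCard s).filter fun 𝓔 => ∀ B ∈ 𝓔, ∀ B' ∈ 𝓔, (B ∩ B').Nonempty

/-- Every two members (possibly equal) of the family meet. -/
def PairwiseMeet (G : Finset (Finset ℕ)) : Prop :=
  ∀ B ∈ G, ∀ B' ∈ G, (B ∩ B').Nonempty

/-- Apply `p` to the set `F` and add the point `v`. -/
def lift (p : ℕ → ℕ) (v : ℕ) (F : Finset ℕ) : Finset ℕ := insert v (F.image p)

open Classical in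
/-- The compression replacing each `F ∌ v` by `lift p v F` whenever the latter is missing. -/
noncomputable def compress (p : ℕ → ℕ) (v : ℕ) (𝓐 : Finset (Finset ℕ)) : Finset (Finset ℕ) :=
  𝓐.image fun F => if v ∉ F ∧ lift p v F ∉ 𝓐 then lift p v F else F

/-- The members of `G` which have to be lifted when `𝓐` is compressed: those displaced by the
compression, and those disjoint from the lift of another such member. -/
inductive Flip (p : ℕ → ℕ) (v : ℕ) (𝓐 G : Finset (Finset ℕ)) : Finset ℕ → Prop
  | base (F : Finset ℕ) : F ∈ G → v ∉ F → lift p v F ∉ 𝓐 → Flip p v 𝓐 G F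
  | step (F H : Finset ℕ) : Flip p v 𝓐 G F → H ∈ G → Disjoint H (lift p v F) →
      Flip p v 𝓐 G H

open Classical in
/-- Lift all members of `G` that have to be lifted. -/
noncomputable def flipFam (p : ℕ → ℕ) (v : ℕ) (𝓐 G : Finset (Finset ℕ)) :
    Finset (Finset ℕ) :=
  G.image fun F => if Flip p v 𝓐 G F then lift p v F else F

theorem mem_interFams {s : ℕ} {𝓐 G : Finset (Finset ℕ)} :
    G ∈ interFams s 𝓐 ↔ G ⊆ 𝓐 ∧ G.card = s ∧ PairwiseMeet G := by
  simp [interFams, PairwiseMeet, mem_powersetCard, and_assoc]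

section lift

variable {p : ℕ → ℕ} {v : ℕ}

theorem mem_lift_self (F : Finset ℕ) : v ∈ lift p v F := by simp [lift]

theorem mem_lift (hp : Function.Involutive p) {F : Finset ℕ} {x : ℕ} :
    x ∈ lift p v F ↔ x = v ∨ p x ∈ F := by
  simp only [lift, mem_insert, mem_image]
  constructor
  · rintro (h | ⟨y, hy, rfl⟩)
    · exact Or.inl h
    · right; rwa [hp y]
  · rintro (h | h)
    · exact Or.inl h
    · exact Or.inr ⟨_, h, hp x⟩

theorem lift_injective (hp : Function.Involutive p) (hv : p v = v) {F H : Finset ℕ}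
    (hF : v ∉ F) (hH : v ∉ H) (h : lift p v F = lift p v H) : F = H := by
  ext x
  have h1 := congrArg (fun S => p x ∈ S) h
  simp only [mem_lift hp, hp x, eq_iff_iff] at h1
  by_cases hx : p x = v
  · have : x = v := by rw [← hp x, hx, hv]
    subst this
    simp [hF, hH]
  · simpa [hx] using h1

theorem lift_disjoint_swap (hp : Function.Involutive p) {F H : Finset ℕ} (hF : v ∉ F)
    (h : Disjoint H (lift p v F)) : Disjoint F (lift p v H) := by
  rw [Finset.disjoint_left] at h ⊢
  intro x hx hx'
  rw [mem_lift hp] at hx'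
  rcases hx' with rfl | hx'
  · exact hF hx
  · exact h hx' ((mem_lift hp).2 (Or.inr (by rwa [hp x])))

theorem card_lift (hp : Function.Involutive p) (hv : p v = v) {F : Finset ℕ} (hF : v ∉ F) :
    (lift p v F).card = F.card + 1 := by
  rw [lift, card_insert_of_notMem, card_image_of_injective _ hp.injective]
  simp only [mem_image, not_exists, not_and]
  intro x hx h
  apply hF
  rwa [← hv, ← h, hp x]

end lift

section flip

variable {p : ℕ → ℕ} {v : ℕ} {𝓐 G : Finset (Finset ℕ)}

theorem not_disjoint_of_pairwiseMeet (hG : PairwiseMeet G) {F H : Finset ℕ} (hF : F ∈ G)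
    (hH : H ∈ G) : ¬ Disjoint F H := by
  rw [Finset.not_disjoint_iff_nonempty_inter]
  exact hG F hF H hH

theorem Flip.mem {F : Finset ℕ} (h : Flip p v 𝓐 G F) : F ∈ G := by
  cases h <;> assumption

theorem Flip.notMem {F : Finset ℕ} (h : Flip p v 𝓐 G F) : v ∉ F := by
  cases h with
  | base _ _ h _ => exact h
  | step F _ _ _ hd => exact fun hv => Finset.disjoint_left.1 hd hv (mem_lift_self F)

theorem Flip.lift_notMem (hp : Function.Involutive p) (hGA : G ⊆ 𝓐) (hG : PairwiseMeet G)
    {F : Finset ℕ} (h : Flip p v 𝓐 G F) : lift p v F ∉ G := by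
  cases h with
  | base _ _ _ h => exact fun hF => h (hGA hF)
  | step F _ hF _ hd =>
    exact fun hH => not_disjoint_of_pairwiseMeet hG hF.mem hH (lift_disjoint_swap hp hF.notMem hd)

theorem mem_flipFam {X : Finset ℕ} : X ∈ flipFam p v 𝓐 G ↔
    (∃ F, Flip p v 𝓐 G F ∧ lift p v F = X) ∨ (X ∈ G ∧ ¬ Flip p v 𝓐 G X) := by
  simp only [flipFam, mem_image]
  constructor
  · rintro ⟨F, hF, rfl⟩
    split_ifs with h
    · exact Or.inl ⟨F, h, rfl⟩
    · exact Or.inr ⟨hF, h⟩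
  · rintro (⟨F, hF, rfl⟩ | ⟨h1, h2⟩)
    · exact ⟨F, hF.mem, if_pos hF⟩
    · exact ⟨X, h1, if_neg h2⟩

theorem mem_compress {X : Finset ℕ} : X ∈ compress p v 𝓐 ↔
    (∃ F ∈ 𝓐, v ∉ F ∧ lift p v F ∉ 𝓐 ∧ lift p v F = X) ∨
      (X ∈ 𝓐 ∧ (v ∉ X → lift p v X ∈ 𝓐)) := by
  simp only [compress, mem_image]
  constructor
  · rintro ⟨F, hF, rfl⟩
    split_ifs with h
    · exact Or.inl ⟨F, hF, h.1, h.2, rfl⟩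
    · refine Or.inr ⟨hF, fun h1 => ?_⟩
      by_contra h2
      exact h ⟨h1, h2⟩
  · rintro (⟨F, hF, h1, h2, rfl⟩ | ⟨h1, h2⟩)
    · exact ⟨F, hF, if_pos ⟨h1, h2⟩⟩
    · exact ⟨X, h1, if_neg fun h => h.2 (h2 h.1)⟩

theorem card_compress (hp : Function.Involutive p) (hv : p v = v) :
    (compress p v 𝓐).card = 𝓐.card := by
  classical
  rw [compress]
  apply card_image_of_injOn
  intro F hF H hH h
  simp only [mem_coe] at hF hH
  dsimp only at h
  split_ifs at h with h1 h2 h2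
  · exact lift_injective hp hv h1.1 h2.1 h
  · exact absurd (h ▸ hH) h1.2
  · exact absurd (h ▸ hF) h2.2
  · exact h

theorem card_flipFam (hp : Function.Involutive p) (hv : p v = v) (hGA : G ⊆ 𝓐)
    (hG : PairwiseMeet G) : (flipFam p v 𝓐 G).card = G.card := by
  classical
  rw [flipFam]
  apply card_image_of_injOn
  intro F hF H hH h
  simp only [mem_coe] at hF hH
  dsimp only at h
  split_ifs at h with h1 h2 h2
  · exact lift_injective hp hv h1.notMem h2.notMem h
  · exact absurd (h ▸ hH) (h1.lift_notMem hp hGA hG)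
  · exact absurd (h ▸ hF) (h2.lift_notMem hp hGA hG)
  · exact h

theorem flipFam_subset (hGA : G ⊆ 𝓐) : flipFam p v 𝓐 G ⊆ compress p v 𝓐 := by
  intro X hX
  rw [mem_compress]
  rcases mem_flipFam.1 hX with ⟨F, hF, rfl⟩ | ⟨h1, h2⟩
  · by_cases h : lift p v F ∈ 𝓐
    · exact Or.inr ⟨h, fun hv => absurd (mem_lift_self F) hv⟩
    · exact Or.inl ⟨F, hGA hF.mem, hF.notMem, h, rfl⟩
  · refine Or.inr ⟨hGA h1, fun hv => ?_⟩
    by_contra h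
    exact h2 (Flip.base X h1 hv h)

theorem pairwiseMeet_flipFam (hG : PairwiseMeet G) : PairwiseMeet (flipFam p v 𝓐 G) := by
  have key : ∀ F, Flip p v 𝓐 G F → ∀ X ∈ G, ¬ Flip p v 𝓐 G X → (X ∩ lift p v F).Nonempty := by
    intro F hF X hX hn
    rw [← Finset.not_disjoint_iff_nonempty_inter]
    exact fun hd => hn (Flip.step F X hF hX hd)
  intro X hX Y hY
  rcases mem_flipFam.1 hX with ⟨F, hF, rfl⟩ | ⟨h1, h2⟩ <;>
    rcases mem_flipFam.1 hY with ⟨H, hH, rfl⟩ | ⟨h3, h4⟩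
  · exact ⟨v, mem_inter.2 ⟨mem_lift_self F, mem_lift_self H⟩⟩
  · rw [inter_comm]; exact key F hF Y h3 h4
  · exact key H hH X h1 h2
  · exact hG X h1 Y h3

theorem flip_of_flipFam_eq (hp : Function.Involutive p) (hv : p v = v)
    {G₁ G₂ : Finset (Finset ℕ)} (hGA : G₂ ⊆ 𝓐) (hG : PairwiseMeet G₂)
    (h : flipFam p v 𝓐 G₁ = flipFam p v 𝓐 G₂) {F : Finset ℕ} (hF : Flip p v 𝓐 G₁ F) :
    Flip p v 𝓐 G₂ F := by
  have key : ∀ F, Flip p v 𝓐 G₁ F → lift p v F ∉ G₂ → Flip p v 𝓐 G₂ F := by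
    intro F hF hn
    have h1 : lift p v F ∈ flipFam p v 𝓐 G₂ := h ▸ mem_flipFam.2 (Or.inl ⟨F, hF, rfl⟩)
    rcases mem_flipFam.1 h1 with ⟨X, hX, he⟩ | ⟨h2, _⟩
    · rwa [← lift_injective hp hv hX.notMem hF.notMem he]
    · exact absurd h2 hn
  induction hF with
  | base F hF hvF hn => exact key F (Flip.base F hF hvF hn) fun h => hn (hGA h)
  | step F H hF hH hd ih =>
    refine key H (Flip.step F H hF hH hd) fun h => ?_
    exact not_disjoint_of_pairwiseMeet hG ih.mem h (lift_disjoint_swap hp hF.notMem hd)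

theorem subset_of_flipFam_eq (hp : Function.Involutive p) (hv : p v = v)
    {G₁ G₂ : Finset (Finset ℕ)} (hGA₁ : G₁ ⊆ 𝓐) (hG₁ : PairwiseMeet G₁)
    (hGA₂ : G₂ ⊆ 𝓐) (hG₂ : PairwiseMeet G₂)
    (h : flipFam p v 𝓐 G₁ = flipFam p v 𝓐 G₂) : G₁ ⊆ G₂ := by
  intro F hF
  by_cases hf : Flip p v 𝓐 G₁ F
  · exact (flip_of_flipFam_eq hp hv hGA₂ hG₂ h hf).mem
  · have h1 : F ∈ flipFam p v 𝓐 G₂ := h ▸ mem_flipFam.2 (Or.inr ⟨hF, hf⟩)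
    rcases mem_flipFam.1 h1 with ⟨X, hX, rfl⟩ | ⟨h2, _⟩
    · exact absurd hF
        ((flip_of_flipFam_eq hp hv hGA₁ hG₁ h.symm hX).lift_notMem hp hGA₁ hG₁)
    · exact h2

theorem flipFam_mem_interFams (hp : Function.Involutive p) (hv : p v = v) {s : ℕ}
    (h : G ∈ interFams s 𝓐) : flipFam p v 𝓐 G ∈ interFams s (compress p v 𝓐) := by
  obtain ⟨h1, h2, h3⟩ := mem_interFams.1 h
  exact mem_interFams.2
    ⟨flipFam_subset h1, (card_flipFam hp hv h1 h3).trans h2, pairwiseMeet_flipFam h3⟩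

theorem flipFam_injOn (hp : Function.Involutive p) (hv : p v = v) (s : ℕ) :
    Set.InjOn (flipFam p v 𝓐) (interFams s 𝓐 : Set (Finset (Finset ℕ))) := by
  intro G₁ h₁ G₂ h₂ h
  obtain ⟨a1, -, a3⟩ := mem_interFams.1 (mem_coe.1 h₁)
  obtain ⟨b1, -, b3⟩ := mem_interFams.1 (mem_coe.1 h₂)
  exact (subset_of_flipFam_eq hp hv a1 a3 b1 b3 h).antisymm
    (subset_of_flipFam_eq hp hv b1 b3 a1 a3 h.symm)

theorem card_interFams_le_compress (hp : Function.Involutive p) (hv : p v = v) (s : ℕ) :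
    (interFams s 𝓐).card ≤ (interFams s (compress p v 𝓐)).card :=
  card_le_card_of_injOn (flipFam p v 𝓐)
    (fun _ h => flipFam_mem_interFams hp hv h) (flipFam_injOn hp hv s)

/-- The compression strictly increases the count as soon as some intersecting family contains a
lifted set together with a set disjoint from the set it was lifted from. -/
theorem card_interFams_lt_compress (hp : Function.Involutive p) (hv : p v = v) {s : ℕ}
    {A Y : Finset ℕ} (hvA : v ∉ A) (hB : lift p v A ∉ 𝓐)
    {G : Finset (Finset ℕ)} (hG : G ∈ interFams s (compress p v 𝓐))
    (hBG : lift p v A ∈ G) (hYG : Y ∈ G) (hYA : Disjoint Y A)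
    (hYp : v ∈ Y → Disjoint Y (A.image p)) :
    (interFams s 𝓐).card < (interFams s (compress p v 𝓐)).card := by
  rw [← card_image_of_injOn (flipFam_injOn hp hv s)]
  refine card_lt_card ((ssubset_iff_of_subset ?_).2 ⟨G, hG, ?_⟩)
  · intro X hX
    obtain ⟨H, hH, rfl⟩ := mem_image.1 hX
    exact flipFam_mem_interFams hp hv hH
  · intro hG'
    obtain ⟨H, hH, rfl⟩ := mem_image.1 hG'
    obtain ⟨h1, -, h3⟩ := mem_interFams.1 hH
    have hA : A ∈ H := by
      rcases mem_flipFam.1 hBG with ⟨F, hF, he⟩ | ⟨h, _⟩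
      · rw [← lift_injective hp hv hF.notMem hvA he]
        exact hF.mem
      · exact absurd (h1 h) hB
    rcases mem_flipFam.1 hYG with ⟨F, hF, rfl⟩ | ⟨h, _⟩
    · refine not_disjoint_of_pairwiseMeet h3 hF.mem hA ?_
      have hd := hYp (mem_lift_self F)
      rw [Finset.disjoint_left] at hd ⊢
      intro x hx hxA
      exact hd ((mem_lift hp).2 (Or.inr (by rwa [hp x]))) (mem_image_of_mem p hxA)
    · exact not_disjoint_of_pairwiseMeet h3 h hA hYA

end flip

theorem mem_allFams {n : ℕ} {A : Finset ℕ} : A ∈ allFams n ↔ A ⊆ groundSet n := by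
  simp [allFams]

theorem card_groundSet (n : ℕ) : (groundSet n).card = n := by simp [groundSet]

theorem mem_layerGE {n r : ℕ} {A : Finset ℕ} :
    A ∈ layerGE n r ↔ A ⊆ groundSet n ∧ r ≤ A.card := by
  simp [layerGE, mem_allFams]

theorem card_layerGE (n r : ℕ) : (layerGE n r).card = ∑ k ∈ Icc r n, n.choose k := by
  have h : layerGE n r = (Icc r n).biUnion fun k => (groundSet n).powersetCard k := by
    ext A
    simp only [mem_layerGE, mem_biUnion, mem_Icc, mem_powersetCard]
    constructor
    · rintro ⟨h1, h2⟩
      exact ⟨A.card, ⟨h2, (card_le_card h1).trans_eq (card_groundSet n)⟩, h1, rfl⟩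
    · rintro ⟨k, ⟨h1, -⟩, h2, rfl⟩
      exact ⟨h2, h1⟩
  rw [h, card_biUnion]
  · simp [card_powersetCard, card_groundSet]
  · intro i _ j _ hij
    rw [Function.onFun, Finset.disjoint_left]
    intro A hA hA'
    exact hij ((mem_powersetCard.1 hA).2.symm.trans (mem_powersetCard.1 hA').2)

section compress

variable {p : ℕ → ℕ} {v n : ℕ} {𝓐 : Finset (Finset ℕ)}

theorem compress_subset_allFams (h𝓐 : 𝓐 ⊆ allFams n) (hpn : ∀ x ∈ groundSet n, p x ∈ groundSet n)
    (hvn : v ∈ groundSet n) : compress p v 𝓐 ⊆ allFams n := by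
  intro X hX
  rcases mem_compress.1 hX with ⟨F, hF, -, -, rfl⟩ | ⟨h, -⟩
  · rw [mem_allFams, lift]
    refine insert_subset hvn fun x hx => ?_
    obtain ⟨y, hy, rfl⟩ := mem_image.1 hx
    exact hpn y (mem_allFams.1 (h𝓐 hF) hy)
  · exact h𝓐 h

theorem layerGE_subset_compress (hp : Function.Involutive p) (hv : p v = v) {r : ℕ}
    (hpn : ∀ x ∈ groundSet n, p x ∈ groundSet n)
    (hvn : v ∈ groundSet n) (hsub : layerGE n r ⊆ 𝓐) : layerGE n r ⊆ compress p v 𝓐 := by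
  intro X hX
  refine mem_compress.2 (Or.inr ⟨hsub hX, fun hvX => hsub ?_⟩)
  rw [mem_layerGE] at hX ⊢
  refine ⟨?_, by rw [card_lift hp hv hvX]; omega⟩
  refine insert_subset hvn fun x hx => ?_
  obtain ⟨y, hy, rfl⟩ := mem_image.1 hx
  exact hpn y (hX.1 hy)

theorem lift_mem_compress {A : Finset ℕ} (hA : A ∈ 𝓐) (hvA : v ∉ A) (hB : lift p v A ∉ 𝓐) :
    lift p v A ∈ compress p v 𝓐 :=
  mem_compress.2 (Or.inl ⟨A, hA, hvA, hB, rfl⟩)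

end compress

/-- A set of size `r < n / 2` lies, with any large set meeting it, in an intersecting family of
any size `s ≤ 2 ^ (n - 1)`, all of whose other members have size greater than `r`. -/
theorem exists_pairwiseMeet {n r s : ℕ} (hn : 1 ≤ n) (hr : 2 * r < n) (hs1 : 2 ≤ s)
    (hs2 : s ≤ 2 ^ (n - 1)) {B Y : Finset ℕ} (hB : B ⊆ groundSet n) (hBr : B.card = r)
    (hr0 : 0 < r) (hY : Y ⊆ groundSet n) (hYr : n < 2 * Y.card) (hYB : (Y ∩ B).Nonempty) :
    ∃ G : Finset (Finset ℕ), B ∈ G ∧ Y ∈ G ∧ G.card = s ∧ PairwiseMeet G ∧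
      ∀ X ∈ G, X ≠ B → X ∈ layerGE n (r + 1) := by
  classical
  let big : Finset ℕ → Prop := fun D => n < 2 * D.card ∨ (n = 2 * D.card ∧ 1 ∈ D)
  let 𝓕 : Finset (Finset ℕ) := (allFams n).filter fun D => B ⊆ D ∨ ((D ∩ B).Nonempty ∧ big D)
  have hBne : B.Nonempty := card_pos.1 (by omega)
  have hmem : ∀ D, D ∈ 𝓕 ↔ D ⊆ groundSet n ∧ (B ⊆ D ∨ ((D ∩ B).Nonempty ∧ big D)) := by
    intro D; simp [𝓕, mem_allFams]
  have hmeet : PairwiseMeet 𝓕 := by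
    intro D hD E hE
    obtain ⟨hDn, hD⟩ := (hmem D).1 hD
    obtain ⟨hEn, hE⟩ := (hmem E).1 hE
    rcases hD with hD | ⟨hD, hDb⟩ <;> rcases hE with hE | ⟨hE, hEb⟩
    · exact hBne.mono (subset_inter hD hE)
    · rw [inter_comm]; exact hE.mono (inter_subset_inter_left hD)
    · exact hD.mono (inter_subset_inter_left hE)
    · by_contra hne
      rw [← Finset.not_disjoint_iff_nonempty_inter, not_not] at hne
      have h1 := card_le_card (union_subset hDn hEn)
      rw [card_union_of_disjoint hne, card_groundSet] at h1
      have h2 : 1 ∈ D ∧ 1 ∈ E := by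
        rcases hDb with h | h <;> rcases hEb with h' | h'
        · omega
        · omega
        · omega
        · exact ⟨h.2, h'.2⟩
      exact Finset.disjoint_left.1 hne h2.1 h2.2
  have hcompl : ∀ D ⊆ groundSet n, D ∈ 𝓕 ∨ groundSet n \ D ∈ 𝓕 := by
    intro D hD
    rw [hmem, hmem]
    by_cases h1 : (D ∩ B).Nonempty
    · by_cases h2 : ((groundSet n \ D) ∩ B).Nonempty
      · have hc := card_sdiff_add_card_eq_card hD
        rw [card_groundSet] at hc
        have h1n : 1 ∈ groundSet n := by simp [groundSet, hn]
        have : big D ∨ big (groundSet n \ D) := by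
          rcases lt_trichotomy n (2 * D.card) with h | h | h
          · exact Or.inl (Or.inl h)
          · by_cases h3 : 1 ∈ D
            · exact Or.inl (Or.inr ⟨h, h3⟩)
            · exact Or.inr (Or.inr ⟨by omega, mem_sdiff.2 ⟨h1n, h3⟩⟩)
          · exact Or.inr (Or.inl (by omega))
        rcases this with h | h
        · exact Or.inl ⟨hD, Or.inr ⟨h1, h⟩⟩
        · exact Or.inr ⟨sdiff_subset, Or.inr ⟨h2, h⟩⟩
      · refine Or.inl ⟨hD, Or.inl fun x hx => ?_⟩
        by_contra hxD
        exact h2 ⟨x, mem_inter.2 ⟨mem_sdiff.2 ⟨hB hx, hxD⟩, hx⟩⟩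
    · refine Or.inr ⟨sdiff_subset, Or.inl fun x hx => mem_sdiff.2 ⟨hB hx, fun hxD => ?_⟩⟩
      exact h1 ⟨x, mem_inter.2 ⟨hxD, hx⟩⟩
  have hcard : s ≤ 𝓕.card := by
    have h1 : allFams n ⊆ 𝓕 ∪ 𝓕.image fun D => groundSet n \ D := by
      intro D hD
      rw [mem_allFams] at hD
      rcases hcompl D hD with h | h
      · exact mem_union_left _ h
      · refine mem_union_right _ (mem_image.2 ⟨_, h, ?_⟩)
        exact Finset.sdiff_sdiff_eq_self hD
    have h2 := (card_le_card h1).trans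
      ((card_union_le _ _).trans (Nat.add_le_add_left card_image_le _))
    rw [allFams, card_powerset, card_groundSet] at h2
    obtain ⟨m, rfl⟩ : ∃ m, n = m + 1 := ⟨n - 1, by omega⟩
    rw [pow_succ] at h2
    simp only [Nat.add_sub_cancel] at hs2
    omega
  have hBY : B ≠ Y := by
    rintro rfl
    omega
  obtain ⟨G, hG1, hG2, hG3⟩ := exists_subsuperset_card_eq (s := {B, Y}) (t := 𝓕) (n := s)
    (by
      intro X hX
      rw [mem_insert, mem_singleton] at hX
      rcases hX with rfl | rfl
      · exact (hmem _).2 ⟨hB, Or.inl subset_rfl⟩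
      · exact (hmem _).2 ⟨hY, Or.inr ⟨hYB, Or.inl hYr⟩⟩)
    (by rw [card_pair hBY]; exact hs1) hcard
  refine ⟨G, hG1 (by simp), hG1 (by simp), hG3,
    fun X hX X' hX' => hmeet X (hG2 hX) X' (hG2 hX'), fun X hX hXB => ?_⟩
  obtain ⟨h1, h2⟩ := (hmem X).1 (hG2 hX)
  refine mem_layerGE.2 ⟨h1, ?_⟩
  rcases h2 with h2 | ⟨-, h2⟩
  · have := card_lt_card (h2.ssubset_of_ne (Ne.symm hXB))
    omega
  · rcases h2 with h2 | ⟨h2, -⟩ <;> omega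

/-- Two finite sets of the same size are exchanged by an involution fixing everything outside
their symmetric difference. -/
theorem exists_involutive_image_eq {A B : Finset ℕ} (h : A.card = B.card) :
    ∃ p : ℕ → ℕ, Function.Involutive p ∧ A.image p = B ∧
      (∀ x, x ∉ A → x ∉ B → p x = x) ∧ ∀ x ∈ A ∪ B, p x ∈ A ∪ B := by
  classical
  have hc : (A \ B).card = (B \ A).card := card_sdiff_comm h
  let e : (A \ B : Finset ℕ) ≃ (B \ A : Finset ℕ) := Finset.equivOfCardEq hc
  let p : ℕ → ℕ := fun x =>
    if hx : x ∈ A \ B then e ⟨x, hx⟩ else if hx : x ∈ B \ A then e.symm ⟨x, hx⟩ else x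
  have hdis : ∀ x, x ∈ B \ A → x ∉ A \ B := by
    intro x hx hx'
    exact (mem_sdiff.1 hx).2 (mem_sdiff.1 hx').1
  have p1 : ∀ x (hx : x ∈ A \ B), p x = e ⟨x, hx⟩ := fun x hx => by simp only [p, dif_pos hx]
  have p2 : ∀ x (hx : x ∈ B \ A), p x = e.symm ⟨x, hx⟩ := fun x hx => by
    simp only [p, dif_pos hx, dif_neg (hdis x hx)]
  have p3 : ∀ x, x ∉ A \ B → x ∉ B \ A → p x = x := fun x h1 h2 => by
    simp only [p, dif_neg h1, dif_neg h2]
  have q1 : ∀ x ∈ A \ B, p x ∈ B \ A := fun x hx => by rw [p1 x hx]; exact (e _).2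
  have q2 : ∀ x ∈ B \ A, p x ∈ A \ B := fun x hx => by rw [p2 x hx]; exact (e.symm _).2
  have hp : Function.Involutive p := by
    intro x
    by_cases h1 : x ∈ A \ B
    · rw [p2 _ (q1 x h1)]
      simp [p1 x h1]
    · by_cases h2 : x ∈ B \ A
      · rw [p1 _ (q2 x h2)]
        simp [p2 x h2]
      · rw [p3 x h1 h2, p3 x h1 h2]
  refine ⟨p, hp, ?_, fun x hA hB => p3 x (by simp [hA]) (by simp [hB]), ?_⟩
  · apply eq_of_subset_of_card_le
    · intro y hy
      obtain ⟨x, hx, rfl⟩ := mem_image.1 hy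
      by_cases hxB : x ∈ B
      · rwa [p3 x (by simp [hxB]) (by simp [hx])]
      · exact (mem_sdiff.1 (q1 x (mem_sdiff.2 ⟨hx, hxB⟩))).1
    · rw [card_image_of_injective _ hp.injective, h]
  · intro x hx
    by_cases h1 : x ∈ A \ B
    · exact mem_union_right _ (mem_sdiff.1 (q1 x h1)).1
    · by_cases h2 : x ∈ B \ A
      · exact mem_union_left _ (mem_sdiff.1 (q2 x h2)).1
      · rwa [p3 x h1 h2]

/-- Lifting a set of size `r - 1` to a missing set of size `r` strictly increases the count. -/
theorem exists_better_of_card_succ {n s r : ℕ} (hn : 1 ≤ n) (hs1 : 2 ≤ s)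
    (hs2 : s ≤ 2 ^ (n - 1)) (hr : 2 * r < n) {𝓐 : Finset (Finset ℕ)} (h𝓐 : 𝓐 ⊆ allFams n)
    (hsub : layerGE n (r + 1) ⊆ 𝓐) {A B : Finset ℕ} (hA : A ∈ 𝓐) (hAr : A.card + 1 = r)
    (hB : B ⊆ groundSet n) (hBr : B.card = r) (hB𝓐 : B ∉ 𝓐) :
    ∃ 𝓐' ⊆ allFams n, 𝓐'.card = 𝓐.card ∧ (interFams s 𝓐).card < (interFams s 𝓐').card := by
  have hAn : A ⊆ groundSet n := mem_allFams.1 (h𝓐 hA)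
  obtain ⟨v, hvB, hvA⟩ : ∃ v ∈ B, v ∉ A := exists_mem_notMem_of_card_lt_card (by omega)
  obtain ⟨p, hp, hpA, hpfix, hpm⟩ := exists_involutive_image_eq (A := A) (B := B.erase v)
    (by rw [card_erase_of_mem hvB]; omega)
  have hv : p v = v := hpfix v hvA (by simp)
  have hvn : v ∈ groundSet n := hB hvB
  have hlift : lift p v A = B := by rw [lift, hpA, insert_erase hvB]
  have hU : A ∪ B.erase v ⊆ groundSet n := union_subset hAn ((erase_subset _ _).trans hB)
  have hpn : ∀ x ∈ groundSet n, p x ∈ groundSet n := by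
    intro x hx
    by_cases h : x ∈ A ∪ B.erase v
    · exact hU (hpm x h)
    · rw [mem_union, not_or] at h
      rwa [hpfix x h.1 h.2]
  obtain ⟨Y, hYn, hYc, hYB, hYA, hYp⟩ : ∃ Y ⊆ groundSet n, n < 2 * Y.card ∧ (Y ∩ B).Nonempty ∧
      Disjoint Y A ∧ (v ∈ Y → Disjoint Y (A.image p)) := by
    by_cases h : B.erase v ⊆ A
    · have hd : Disjoint (groundSet n \ A) A := sdiff_disjoint
      have hc := card_sdiff_add_card_eq_card hAn
      rw [card_groundSet] at hc
      refine ⟨groundSet n \ A, sdiff_subset, by omega, ⟨v, ?_⟩, hd, fun _ => ?_⟩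
      · simp [hvn, hvA, hvB]
      · rw [hpA]
        exact hd.mono_right h
    · obtain ⟨w, hw, hwA⟩ := not_subset.1 h
      rw [mem_erase] at hw
      have hc := card_sdiff_add_card_eq_card (insert_subset hvn hAn)
      rw [card_groundSet, card_insert_of_notMem hvA] at hc
      refine ⟨groundSet n \ insert v A, sdiff_subset, by omega, ⟨w, ?_⟩,
        sdiff_disjoint.mono_right (subset_insert v A), fun hvY => ?_⟩
      · simp [hB hw.2, hw, hwA]
      · simp at hvY
  obtain ⟨G, hBG, hYG, hGs, hGm, hGL⟩ := exists_pairwiseMeet hn hr hs1 hs2 hB hBr (by omega) hYn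
    hYc hYB
  refine ⟨compress p v 𝓐, compress_subset_allFams h𝓐 hpn hvn, card_compress hp hv,
    card_interFams_lt_compress hp hv hvA (by rwa [hlift])
      (mem_interFams.2 ⟨fun X hX => ?_, hGs, hGm⟩) (by rwa [hlift]) hYG hYA hYp⟩
  by_cases hXB : X = B
  · rw [hXB, ← hlift]
    exact lift_mem_compress hA hvA (by rwa [hlift])
  · exact layerGE_subset_compress hp hv hpn hvn hsub (hGL X hX hXB)

theorem exists_better {n s r : ℕ} (hn : 1 ≤ n) (hs1 : 2 ≤ s)
    (hs2 : s ≤ 2 ^ (n - 1)) (hr : 2 * r < n) (j : ℕ) {𝓐 : Finset (Finset ℕ)}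
    (h𝓐 : 𝓐 ⊆ allFams n) (hsub : layerGE n (r + 1) ⊆ 𝓐)
    (hcard : 𝓐.card < (layerGE n r).card) (hsmall : ∃ A ∈ 𝓐, A.card + 1 + j = r) :
    ∃ 𝓐' ⊆ allFams n, 𝓐'.card = 𝓐.card ∧ (interFams s 𝓐).card < (interFams s 𝓐').card := by
  induction j generalizing 𝓐 with
  | zero =>
    obtain ⟨A, hA, hAr⟩ := hsmall
    obtain ⟨B, hB, hB𝓐⟩ := exists_mem_notMem_of_card_lt_card hcard
    obtain ⟨hBn, hBr⟩ := mem_layerGE.1 hB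
    have hBr' : B.card = r := by
      by_contra hne
      exact hB𝓐 (hsub (mem_layerGE.2 ⟨hBn, by omega⟩))
    exact exists_better_of_card_succ hn hs1 hs2 hr h𝓐 hsub hA (by omega) hBn hBr' hB𝓐
  | succ j ih =>
    by_cases hex : ∃ A ∈ 𝓐, A.card + 1 + j = r
    · exact ih h𝓐 hsub hcard hex
    obtain ⟨A, hA, hAr⟩ := hsmall
    obtain ⟨v, hvn, hvA⟩ : ∃ v ∈ groundSet n, v ∉ A :=
      exists_mem_notMem_of_card_lt_card (by rw [card_groundSet]; omega)
    have hp : Function.Involutive (id : ℕ → ℕ) := fun _ => rfl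
    have hv : id v = v := rfl
    have hpn : ∀ x ∈ groundSet n, id x ∈ groundSet n := fun _ h => h
    have hlc : (lift id v A).card + 1 + j = r := by
      rw [card_lift hp hv hvA]; omega
    have hl : lift id v A ∉ 𝓐 := fun h => hex ⟨_, h, hlc⟩
    have hc : (compress id v 𝓐).card = 𝓐.card := card_compress hp hv
    obtain ⟨𝓐', h1, h2, h3⟩ := ih (compress_subset_allFams h𝓐 hpn hvn)
      (layerGE_subset_compress hp hv hpn hvn hsub) (by rwa [hc])
      ⟨_, lift_mem_compress hA hvA hl, hlc⟩
    exact ⟨𝓐', h1, h2.trans hc, (card_interFams_le_compress hp hv s).trans_lt h3⟩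

theorem stmt8 (n N s r : ℕ) (hn : 1 ≤ n) (hN0 : 1 ≤ N) (hN : N ≤ 2 ^ n)
    (hs1 : 2 ≤ s) (hs2 : s ≤ 2 ^ (n - 1))
    (hr1 : ∑ k ∈ Finset.Icc (r + 1) n, n.choose k ≤ N)
    (hr2 : N < ∑ k ∈ Finset.Icc r n, n.choose k)
    (hr : (r : ℝ) < (n : ℝ) / 2)
    (𝓐 : Finset (Finset ℕ)) (h𝓐 : 𝓐 ⊆ allFams n) (hcard : 𝓐.card = N)
    (hsub : layerGE n (r + 1) ⊆ 𝓐) (hsmall : ∃ A ∈ 𝓐, A.card < r) :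
    ∃ 𝓐' ⊆ allFams n, 𝓐'.card = N ∧
      (interFams s 𝓐).card < (interFams s 𝓐').card := by
  have hr' : 2 * r < n := by
    have h : (2 * r : ℝ) < n := by linarith
    exact_mod_cast h
  obtain ⟨A, hA, hAr⟩ := hsmall
  subst hcard
  exact exists_better hn hs1 hs2 hr' (r - 1 - A.card) h𝓐 hsub
    (by rwa [card_layerGE]) ⟨A, hA, by omega⟩
end

section
/- Let n ≥ 4 and let s be a positive integer. Then |𝕀_𝒯| ≤ |𝕀_3|, where 𝕀_𝒯 is the collection of intersecting families 𝓔 of subsets of [n], each of size at least 2, with |𝓔| = s and 𝓔 ∩ [n]^(2) = 𝒯 = {{1,2},{1,3},{2,3}}, and 𝕀_3 is the collection of intersecting families 𝓔 of subsets of [n], each of size at least 2, with |𝓔| = s and 𝓔 ∩ [n]^(2) = 𝒮_3 = {{1,2},{1,3},{1,4}}. -/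
open Finset

/-- The collection of intersecting families `𝓔 ⊆ [n]^(≥2)` with `|𝓔| = s` and
`𝓔 ∩ [n]^(2) = T`. -/
def interLayerFams (n s : ℕ) (T : Finset (Finset ℕ)) : Finset (Finset (Finset ℕ)) :=
  ((layerGE n 2).powersetCard s).filter fun 𝓔 =>
    (∀ B ∈ 𝓔, ∀ B' ∈ 𝓔, (B ∩ B').Nonempty) ∧ 𝓔 ∩ layerEQ n 2 = T

/-- The star `𝒮_j = {{1, t} : 2 ≤ t ≤ j + 1}`. -/
def star (j : ℕ) : Finset (Finset ℕ) := (Finset.Icc 2 (j + 1)).image fun t => {1, t}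

/-- If `F` contains at most one and `G` at least one of each complementary pair of subsets of `S`,
then `F` is no larger than `G`. -/
theorem card_le_card_of_compl {α : Type*} [DecidableEq α] {S : Finset α} {F G : Finset (Finset α)}
    (hFS : ∀ A ∈ F, A ⊆ S) (hF : ∀ A ∈ F, S \ A ∉ F) (hG : ∀ A ⊆ S, A ∉ G → S \ A ∈ G) :
    F.card ≤ G.card := by
  refine card_le_card_of_injOn (fun A => if A ∈ G then A else S \ A) ?_ ?_
  · intro A hA
    have hA' := hFS A hA
    by_cases h : A ∈ G
    · simp [h]
    · simpa [h] using hG A hA' h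
  · intro A hA B hB h
    have hAS := hFS A hA
    have hBS := hFS B hB
    by_cases h1 : A ∈ G <;> by_cases h2 : B ∈ G <;> simp only [h1, h2, if_true, if_false] at h
    · exact h
    · exact absurd (h ▸ hA) (hF B hB)
    · exact absurd (h ▸ hB) (hF A hA)
    · rw [← Finset.sdiff_sdiff_eq_self hAS, h, Finset.sdiff_sdiff_eq_self hBS]

theorem mem_interLayerFams {n s : ℕ} {T E : Finset (Finset ℕ)} :
    E ∈ interLayerFams n s T ↔ (E ⊆ layerGE n 2 ∧ E.card = s) ∧
      (∀ B ∈ E, ∀ B' ∈ E, (B ∩ B').Nonempty) ∧ E ∩ layerEQ n 2 = T := by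
  simp [interLayerFams, mem_powersetCard]

theorem mem_layerEQ {n r : ℕ} {A : Finset ℕ} :
    A ∈ layerEQ n r ↔ A ⊆ groundSet n ∧ A.card = r := by
  simp [layerEQ, mem_powersetCard]

theorem subset_of_mem_interLayerFams {n s : ℕ} {T E : Finset (Finset ℕ)}
    (hE : E ∈ interLayerFams n s T) : T ⊆ E := by
  rw [← (mem_interLayerFams.1 hE).2.2]
  exact inter_subset_left

theorem card_interLayerFams_le {n s : ℕ} {T F : Finset (Finset ℕ)}
    (hF : ∀ E ∈ interLayerFams n s T, E ⊆ F) (hTF : T ⊆ F) :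
    (interLayerFams n s T).card ≤ (F.card - T.card).choose (s - T.card) := by
  rw [← card_sdiff_of_subset hTF, ← card_powersetCard]
  refine card_le_card_of_injOn (· \ T) ?_ ?_
  · intro E hE
    have hTE := subset_of_mem_interLayerFams hE
    simp only [mem_coe, mem_powersetCard, card_sdiff_of_subset hTE,
      (mem_interLayerFams.1 hE).1.2, and_true]
    exact sdiff_subset_sdiff (hF E hE) le_rfl
  · intro E hE E' hE' h
    rw [← sdiff_union_of_subset (subset_of_mem_interLayerFams hE),
      ← sdiff_union_of_subset (subset_of_mem_interLayerFams hE')]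
    exact congrArg (· ∪ T) h

theorem choose_le_card_interLayerFams {n s : ℕ} {T F : Finset (Finset ℕ)}
    (hF : F ⊆ layerGE n 2) (hint : ∀ B ∈ F, ∀ B' ∈ F, (B ∩ B').Nonempty)
    (hT : F ∩ layerEQ n 2 = T) (hs : T.card ≤ s) :
    (F.card - T.card).choose (s - T.card) ≤ (interLayerFams n s T).card := by
  have hTF : T ⊆ F := hT ▸ inter_subset_left
  rw [← card_sdiff_of_subset hTF, ← card_powersetCard]
  refine card_le_card_of_injOn (· ∪ T) ?_ ?_
  · intro P hP
    obtain ⟨hPF, hPs⟩ := mem_powersetCard.1 hP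
    have hd : Disjoint P T := disjoint_of_subset_left hPF sdiff_disjoint
    have hPT : P ∪ T ⊆ F := union_subset (hPF.trans sdiff_subset) hTF
    refine mem_interLayerFams.2 ⟨⟨hPT.trans hF, ?_⟩, fun B hB B' hB' =>
      hint B (hPT hB) B' (hPT hB'), ?_⟩
    · rw [card_union_of_disjoint hd, hPs]
      omega
    · refine Subset.antisymm ?_ ?_
      · exact (inter_subset_inter_right hPT).trans hT.subset
      · refine subset_inter subset_union_right ?_
        rw [← hT]
        exact inter_subset_right
  · intro P hP Q hQ h
    have hdP : Disjoint P T :=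
      disjoint_of_subset_left (mem_powersetCard.1 hP).1 sdiff_disjoint
    have hdQ : Disjoint Q T :=
      disjoint_of_subset_left (mem_powersetCard.1 hQ).1 sdiff_disjoint
    rw [← union_sdiff_cancel_right hdP, ← union_sdiff_cancel_right hdQ]
    exact congrArg (· \ T) h

/-- The subsets of `[n]` meeting `{1, 2, 3}` in at least two elements. -/
def twoOfThree (n : ℕ) : Finset (Finset ℕ) :=
  (groundSet n).powerset.filter fun A => 1 ∈ A ∧ 2 ∈ A ∨ 1 ∈ A ∧ 3 ∈ A ∨ 2 ∈ A ∧ 3 ∈ A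

/-- A maximal intersecting family of subsets of `[n]` whose `2`-element members form `star 3`. -/
def starExtension (n : ℕ) : Finset (Finset ℕ) :=
  (groundSet n).powerset.filter fun A =>
    1 ∈ A ∧ 3 ≤ A.card ∨ A ∈ _root_.star 3 ∨
      (1 ∉ A ∧ 2 ∈ A ∧ 3 ∈ A ∧ 4 ∈ A) ∧ (groundSet n \ A).card ≤ 2

theorem mem_star_three {A : Finset ℕ} :
    A ∈ _root_.star 3 ↔ A = {1, 2} ∨ A = {1, 3} ∨ A = {1, 4} := by
  have h : _root_.star 3 = {{1, 2}, {1, 3}, {1, 4}} := by decide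
  simp [h]

theorem mem_twoOfThree {n : ℕ} {A : Finset ℕ} : A ∈ twoOfThree n ↔ A ⊆ groundSet n ∧
    (1 ∈ A ∧ 2 ∈ A ∨ 1 ∈ A ∧ 3 ∈ A ∨ 2 ∈ A ∧ 3 ∈ A) := by
  simp [twoOfThree]

theorem mem_starExtension {n : ℕ} {A : Finset ℕ} : A ∈ starExtension n ↔ A ⊆ groundSet n ∧
    (1 ∈ A ∧ 3 ≤ A.card ∨ A ∈ _root_.star 3 ∨
      (1 ∉ A ∧ 2 ∈ A ∧ 3 ∈ A ∧ 4 ∈ A) ∧ (groundSet n \ A).card ≤ 2) := by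
  simp [starExtension]

theorem pair_eq_of_card_le_two {A : Finset ℕ} {a b : ℕ} (hab : a ≠ b) (ha : a ∈ A) (hb : b ∈ A)
    (hA : A.card ≤ 2) : A = {a, b} := by
  refine (eq_of_subset_of_card_le ?_ ?_).symm
  · simp [insert_subset_iff, ha, hb]
  · rwa [card_pair hab]

theorem mem_star_three_of_card_le_two {A : Finset ℕ} (h1 : 1 ∈ A) (hA : A.card ≤ 2)
    (h : 2 ∈ A ∨ 3 ∈ A ∨ 4 ∈ A) : A ∈ _root_.star 3 := by
  rw [mem_star_three]
  rcases h with h | h | h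
  · exact .inl (pair_eq_of_card_le_two (by decide) h1 h hA)
  · exact .inr (.inl (pair_eq_of_card_le_two (by decide) h1 h hA))
  · exact .inr (.inr (pair_eq_of_card_le_two (by decide) h1 h hA))

theorem three_le_card_of_mem {A : Finset ℕ} (h2 : 2 ∈ A) (h3 : 3 ∈ A) (h4 : 4 ∈ A) :
    3 ≤ A.card := by
  have h : ({2, 3, 4} : Finset ℕ) ⊆ A := by simp [insert_subset_iff, h2, h3, h4]
  exact card_le_card h

theorem card_twoOfThree_le {n : ℕ} (hn : 4 ≤ n) :
    (twoOfThree n).card ≤ (starExtension n).card := by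
  have hm : ∀ k, 1 ≤ k → k ≤ 4 → k ∈ groundSet n := fun k h h' => by
    simp only [groundSet, mem_Icc]
    omega
  refine card_le_card_of_compl (S := groundSet n) (fun A hA => (mem_twoOfThree.1 hA).1) ?_ ?_
  · intro A hA hA'
    simp only [mem_twoOfThree, mem_sdiff] at hA hA'
    tauto
  · intro A hA hAG
    rw [mem_starExtension] at hAG ⊢
    refine ⟨sdiff_subset, ?_⟩
    rw [Finset.sdiff_sdiff_eq_self hA]
    have h1 := hm 1 (by decide) (by decide)
    have h2 := hm 2 (by decide) (by decide)
    have h3 := hm 3 (by decide) (by decide)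
    have h4 := hm 4 (by decide) (by decide)
    by_cases hA1 : 1 ∈ A
    · have hc : A.card ≤ 2 := by
        by_contra! h
        exact hAG ⟨hA, .inl ⟨hA1, h⟩⟩
      have hs : ¬(2 ∈ A ∨ 3 ∈ A ∨ 4 ∈ A) := fun h =>
        hAG ⟨hA, .inr (.inl (mem_star_three_of_card_le_two hA1 hc h))⟩
      push Not at hs
      exact .inr (.inr ⟨by simp [hA1, h2, h3, h4, hs], hc⟩)
    · have hC1 : 1 ∈ groundSet n \ A := mem_sdiff.2 ⟨h1, hA1⟩
      by_cases hc : 3 ≤ (groundSet n \ A).card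
      · exact .inl ⟨hC1, hc⟩
      · refine .inr (.inl (mem_star_three_of_card_le_two hC1 (by omega) ?_))
        by_contra! h
        simp only [mem_sdiff, h2, h3, h4, true_and, not_not] at h
        exact hAG ⟨hA, .inr (.inr ⟨⟨hA1, h⟩, by omega⟩)⟩

theorem starExtension_intersecting {n : ℕ} :
    ∀ B ∈ starExtension n, ∀ B' ∈ starExtension n, (B ∩ B').Nonempty := by
  have key : ∀ B ∈ starExtension n, ∀ B' ∈ starExtension n, 1 ∈ B → 1 ∉ B' →
      (B ∩ B').Nonempty := by
    intro B hB B' hB' h1 h1'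
    obtain ⟨hBs, hB⟩ := mem_starExtension.1 hB
    obtain ⟨-, hB'⟩ := mem_starExtension.1 hB'
    have hs : B' ∉ _root_.star 3 := by
      rw [mem_star_three]
      rintro (rfl | rfl | rfl) <;> simp at h1'
    obtain ⟨⟨-, h2, h3, h4⟩, hc⟩ : (1 ∉ B' ∧ 2 ∈ B' ∧ 3 ∈ B' ∧ 4 ∈ B') ∧
      (groundSet n \ B').card ≤ 2 := by tauto
    rcases hB with ⟨-, h⟩ | h | h
    · rw [← not_disjoint_iff_nonempty_inter]
      intro hd
      have := card_le_card (subset_sdiff.2 ⟨hBs, hd⟩)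
      omega
    · rcases mem_star_three.1 h with rfl | rfl | rfl
      · exact ⟨2, by simp [h2]⟩
      · exact ⟨3, by simp [h3]⟩
      · exact ⟨4, by simp [h4]⟩
    · exact absurd h1 h.1.1
  intro B hB B' hB'
  by_cases h : 1 ∈ B <;> by_cases h' : 1 ∈ B'
  · exact ⟨1, mem_inter.2 ⟨h, h'⟩⟩
  · exact key B hB B' hB' h h'
  · rw [inter_comm]
    exact key B' hB' B hB h' h
  · refine ⟨2, ?_⟩
    have h2 : ∀ C ∈ starExtension n, 1 ∉ C → 2 ∈ C := by
      intro C hC hC1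
      rcases (mem_starExtension.1 hC).2 with h | h | h
      · exact absurd h.1 hC1
      · rcases mem_star_three.1 h with rfl | rfl | rfl <;> simp at hC1
      · exact h.1.2.1
    exact mem_inter.2 ⟨h2 B hB h, h2 B' hB' h'⟩

theorem card_of_mem_star_three {A : Finset ℕ} (h : A ∈ _root_.star 3) : A.card = 2 := by
  rcases mem_star_three.1 h with rfl | rfl | rfl <;> rfl

theorem starExtension_subset_layerGE {n : ℕ} : starExtension n ⊆ layerGE n 2 := by
  intro A hA
  obtain ⟨hAs, h | h | h⟩ := mem_starExtension.1 hA
  · exact mem_layerGE.2 ⟨hAs, by omega⟩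
  · exact mem_layerGE.2 ⟨hAs, (card_of_mem_star_three h).ge⟩
  · have := three_le_card_of_mem h.1.2.1 h.1.2.2.1 h.1.2.2.2
    exact mem_layerGE.2 ⟨hAs, by omega⟩

theorem starExtension_inter_layerEQ {n : ℕ} (hn : 4 ≤ n) :
    starExtension n ∩ layerEQ n 2 = _root_.star 3 := by
  ext A
  rw [mem_inter, mem_layerEQ]
  constructor
  · rintro ⟨hA, -, hc⟩
    obtain ⟨hAs, h | h | h⟩ := mem_starExtension.1 hA
    · omega
    · exact h
    · have := three_le_card_of_mem h.1.2.1 h.1.2.2.1 h.1.2.2.2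
      omega
  · intro h
    have hs : A ⊆ groundSet n := by
      rcases mem_star_three.1 h with rfl | rfl | rfl <;>
        simp only [insert_subset_iff, singleton_subset_iff, groundSet, mem_Icc] <;> omega
    exact ⟨mem_starExtension.2 ⟨hs, .inr (.inl h)⟩, hs, card_of_mem_star_three h⟩

theorem subset_twoOfThree {n s : ℕ} {E : Finset (Finset ℕ)}
    (hE : E ∈ interLayerFams n s {({1, 2} : Finset ℕ), {1, 3}, {2, 3}}) : E ⊆ twoOfThree n := by
  intro B hB
  have hT := subset_of_mem_interLayerFams hE
  obtain ⟨⟨hEs, -⟩, hint, -⟩ := mem_interLayerFams.1 hE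
  have meets : ∀ a b : ℕ, ({a, b} : Finset ℕ) ∈ E → a ∈ B ∨ b ∈ B := by
    intro a b hab
    obtain ⟨x, hx⟩ := hint B hB _ hab
    simp only [mem_inter, mem_insert, mem_singleton] at hx
    obtain ⟨hx, rfl | rfl⟩ := hx
    · exact .inl hx
    · exact .inr hx
  have h12 := meets 1 2 (hT (by simp))
  have h13 := meets 1 3 (hT (by simp))
  have h23 := meets 2 3 (hT (by simp))
  refine mem_twoOfThree.2 ⟨(mem_layerGE.1 (hEs hB)).1, ?_⟩
  tauto

theorem triangle_subset_twoOfThree {n : ℕ} (hn : 4 ≤ n) :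
    {({1, 2} : Finset ℕ), {1, 3}, {2, 3}} ⊆ twoOfThree n := by
  intro A hA
  simp only [mem_insert, mem_singleton] at hA
  rw [mem_twoOfThree]
  rcases hA with rfl | rfl | rfl <;>
    simp [insert_subset_iff, groundSet] <;> omega

theorem stmt10 (n s : ℕ) (hn : 4 ≤ n) (hs : 1 ≤ s) :
    (interLayerFams n s {({1, 2} : Finset ℕ), {1, 3}, {2, 3}}).card ≤
      (interLayerFams n s (star 3)).card := by
  have hT : ({({1, 2} : Finset ℕ), {1, 3}, {2, 3}} : Finset (Finset ℕ)).card = 3 := by decide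
  have hS : (_root_.star 3).card = 3 := by decide
  rcases (interLayerFams n s {({1, 2} : Finset ℕ), {1, 3}, {2, 3}}).eq_empty_or_nonempty with
    h | ⟨E, hE⟩
  · simp [h]
  have h3s : 3 ≤ s := by
    rw [← hT, ← (mem_interLayerFams.1 hE).1.2]
    exact card_le_card (subset_of_mem_interLayerFams hE)
  calc _ ≤ ((twoOfThree n).card - 3).choose (s - 3) :=
        hT ▸ card_interLayerFams_le (fun _ => subset_twoOfThree) (triangle_subset_twoOfThree hn)
    _ ≤ ((starExtension n).card - 3).choose (s - 3) :=
        Nat.choose_le_choose _ (Nat.sub_le_sub_right (card_twoOfThree_le hn) 3)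
    _ ≤ _ := hS ▸ choose_le_card_interLayerFams starExtension_subset_layerGE
        starExtension_intersecting (starExtension_inter_layerEQ hn) (hS ▸ h3s)
end

section
/- Let n ≥ 21 and let s be a positive integer. For 0 ≤ j ≤ n−1 let 𝕀_j denote the collection of intersecting families 𝓔 ⊆ [n]^(≥2) with |𝓔| = s and 𝓔 ∩ [n]^(2) = 𝒮_j, where 𝒮_j = {{1,t} : 2 ≤ t ≤ j+1}. Then 2·|𝕀_2| ≥ (2^(n−4) − (n−1))·|𝕀_3|. -/
open Finset

/-- The families obtained from a family with trace `star 3` on the pairs by moving `{1, 4}` to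
`{1, 4} ∪ X`. -/
structure IsShifted (n : ℕ) (X : Finset ℕ) (E : Finset (Finset ℕ)) : Prop where
  sub : ∀ A ∈ E, A ⊆ Icc 1 n
  two : ∀ A ∈ E, 2 ≤ A.card
  inter : ∀ A ∈ E, ∀ B ∈ E, (A ∩ B).Nonempty
  mem12 : {1, 2} ∈ E
  mem13 : {1, 3} ∈ E
  memX : insert 1 (insert 4 X) ∈ E
  pair : ∀ A ∈ E, A.card = 2 → A = {1, 2} ∨ A = {1, 3} ∨ A = {1, 4}
  tail : ∀ A ∈ E, 1 ∉ A → 2 ∈ A ∧ 3 ∈ A ∧ 4 ∈ A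

/-- `X` misses some member of `E` that does not contain `1`. -/
def Avoids (E : Finset (Finset ℕ)) (X : Finset ℕ) : Prop :=
  ∃ B ∈ E, 1 ∉ B ∧ Disjoint X B

/-- Exchange `{1, 4}` and `{1, 4} ∪ X`. -/
def shift (X : Finset ℕ) : Equiv.Perm (Finset ℕ) :=
  Equiv.swap {1, 4} (insert 1 (insert 4 X))

/-- Complement the sets that contain `4` and lie inside `{1, 4} ∪ X`. -/
def complBelow (n : ℕ) (X A : Finset ℕ) : Finset ℕ :=
  if 4 ∈ A ∧ A ⊆ insert 1 (insert 4 X) then Icc 1 n \ A else A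

open Classical in
/-- On the sets whose trace on `[5, n]` (or its complement, if `1` is missing) satisfies `R`,
rotate the four complementary types `{1}`, `{1, 4}`, `{2, 3, 4}`, `{2, 3}`. -/
noncomputable def rotateTypes (n : ℕ) (R : Finset ℕ → Prop) (A : Finset ℕ) : Finset ℕ :=
  if 1 ∉ A then A.erase 4
  else if 2 ∈ A ∨ 3 ∈ A then A
  else if ¬ R (A ∩ Icc 5 n) then A
  else if 4 ∈ A then insert 4 (Icc 1 n \ A) else insert 4 A

/-- The traces affected by the rotation. -/
def Affected (E : Finset (Finset ℕ)) (X Y : Finset ℕ) : Prop := Y ⊆ X ∨ Avoids E Y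

/-- The sets that may occur in a shifted family. -/
def legalSets (n : ℕ) : Set (Finset ℕ) :=
  {A | A ⊆ Icc 1 n ∧ (1 ∉ A → 2 ∈ A ∧ 3 ∈ A ∧ 4 ∈ A)}

lemma mem_interLayerFams_star_two {n s : ℕ} {E : Finset (Finset ℕ)}
    (hcard : E.card = s) (hsub : ∀ A ∈ E, A ⊆ Icc 1 n) (htwo : ∀ A ∈ E, 2 ≤ A.card)
    (hinter : ∀ A ∈ E, ∀ B ∈ E, (A ∩ B).Nonempty) (h12 : {1, 2} ∈ E) (h13 : {1, 3} ∈ E)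
    (hpair : ∀ A ∈ E, A.card = 2 → A = {1, 2} ∨ A = {1, 3}) :
    E ∈ interLayerFams n s (star 2) := by
  have hstar : _root_.star 2 = {{1, 2}, {1, 3}} := by decide
  simp only [interLayerFams, mem_filter, mem_powersetCard, hstar]
  refine ⟨⟨fun A hA => ?_, hcard⟩, hinter, ?_⟩
  · simpa [layerGE, allFams, groundSet] using ⟨hsub A hA, htwo A hA⟩
  · ext A
    simp only [mem_inter, layerEQ, groundSet, mem_powersetCard, mem_insert, mem_singleton]
    constructor
    · rintro ⟨hA, -, h2⟩
      exact hpair A hA h2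
    · rintro (rfl | rfl)
      · exact ⟨h12, hsub _ h12, rfl⟩
      · exact ⟨h13, hsub _ h13, rfl⟩

lemma shift_apply_of_one_notMem {X A : Finset ℕ} (h : 1 ∉ A) : shift X A = A := by
  apply Equiv.swap_apply_of_ne_of_ne <;> rintro rfl <;> simp at h

lemma isShifted_image_shift {n s : ℕ} {X : Finset ℕ} {E : Finset (Finset ℕ)} (hn : 5 ≤ n)
    (hX : X ⊆ Icc 5 n) (hE : E ∈ interLayerFams n s (star 3)) :
    IsShifted n X (E.image (shift X)) := by
  have hstar : _root_.star 3 = {{1, 2}, {1, 3}, {1, 4}} := by decide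
  simp only [interLayerFams, mem_filter, mem_powersetCard, hstar] at hE
  obtain ⟨⟨hsub, -⟩, hinter, htr⟩ := hE
  have hmem : ∀ A, (A ∈ E ∧ A ∈ layerEQ n 2) ↔ (A = {1, 2} ∨ A = {1, 3} ∨ A = {1, 4}) := by
    intro A
    rw [← mem_inter, htr]
    simp
  have hG : ∀ A ∈ E, A ⊆ Icc 1 n ∧ 2 ≤ A.card := fun A hA => by
    simpa [layerGE, allFams, groundSet] using hsub hA
  have h12 : {1, 2} ∈ E := ((hmem {1, 2}).2 (by simp)).1
  have h13 : {1, 3} ∈ E := ((hmem {1, 3}).2 (by simp)).1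
  have h14 : {1, 4} ∈ E := ((hmem {1, 4}).2 (by simp)).1
  have htail : ∀ A ∈ E, 1 ∉ A → 2 ∈ A ∧ 3 ∈ A ∧ 4 ∈ A := by
    intro A hA h1
    have a := hinter A hA _ h12
    have b := hinter A hA _ h13
    have c := hinter A hA _ h14
    simp only [Finset.Nonempty, mem_inter, mem_insert, mem_singleton] at a b c
    grind
  have hX1 : ∀ x ∈ X, 5 ≤ x ∧ x ≤ n := fun x hx => by simpa using hX hx
  have hcases : ∀ A ∈ E.image (shift X), A ∈ E ∨ A = insert 1 (insert 4 X) := by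
    intro A hA
    obtain ⟨B, hB, rfl⟩ := mem_image.1 hA
    simp only [shift, Equiv.swap_apply_def]
    split_ifs <;> simp_all
  have hsubX : insert 1 (insert 4 X) ⊆ Icc 1 n := by
    intro x hx
    simp only [mem_insert, mem_Icc] at hx ⊢
    grind
  have h14X : ({1, 4} : Finset ℕ) ⊆ insert 1 (insert 4 X) := by
    intro x; simp only [mem_insert, mem_singleton]; tauto
  have hfix : ∀ t ∈ ({2, 3} : Finset ℕ), shift X {1, t} = {1, t} := by
    intro t ht
    apply Equiv.swap_apply_of_ne_of_ne
    · intro h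
      have := Finset.ext_iff.1 h 4
      simp at this ht
      omega
    · intro h
      have := Finset.ext_iff.1 h 4
      simp at this ht
      omega
  have htail' : ∀ A ∈ E.image (shift X), 1 ∉ A → 2 ∈ A ∧ 3 ∈ A ∧ 4 ∈ A := by
    intro A hA h1
    rcases hcases A hA with h | rfl
    · exact htail A h h1
    · simp at h1
  refine ⟨?_, ?_, ?_, ?_, ?_, ?_, ?_, htail'⟩
  · intro A hA
    rcases hcases A hA with h | rfl
    exacts [(hG A h).1, hsubX]
  · intro A hA
    rcases hcases A hA with h | rfl
    exacts [(hG A h).2, card_le_card h14X]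
  · have key : ∀ A ∈ E.image (shift X), (A ∩ insert 1 (insert 4 X)).Nonempty := by
      intro A hA
      by_cases h1 : 1 ∈ A
      · exact ⟨1, by simp [h1]⟩
      · exact ⟨4, by simp [htail' A hA h1]⟩
    intro A hA B hB
    rcases hcases A hA with h | rfl
    · rcases hcases B hB with h' | rfl
      · exact hinter A h B h'
      · exact key A hA
    · rw [inter_comm]
      exact key B hB
  · exact mem_image.2 ⟨_, h12, hfix 2 (by simp)⟩
  · exact mem_image.2 ⟨_, h13, hfix 3 (by simp)⟩
  · exact mem_image.2 ⟨_, h14, Equiv.swap_apply_left _ _⟩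
  · intro A hA h2
    rcases hcases A hA with h | rfl
    · exact (hmem A).1 ⟨h, by simpa [layerEQ, groundSet] using ⟨(hG A h).1, h2⟩⟩
    · right; right
      exact (eq_of_subset_of_card_le h14X (by rw [h2]; rfl)).symm

lemma IsShifted.subset_legalSets {n : ℕ} {X : Finset ℕ} {E : Finset (Finset ℕ)}
    (h : IsShifted n X E) : (E : Set (Finset ℕ)) ⊆ legalSets n :=
  fun A hA => ⟨h.sub A hA, h.tail A hA⟩


lemma complBelow_spec {n : ℕ} {X A : Finset ℕ} (hX : X ⊆ Icc 5 n)
    (hA : A ∈ legalSets n) :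
    (complBelow n X A = A ∧ ¬ (4 ∈ A ∧ A ⊆ insert 1 (insert 4 X))) ∨
      (complBelow n X A = Icc 1 n \ A ∧ A ⊆ insert 1 (insert 4 X) ∧
        4 ∈ A ∧ 1 ∈ A ∧ 2 ∉ A ∧ 3 ∉ A) := by
  by_cases h : 4 ∈ A ∧ A ⊆ insert 1 (insert 4 X)
  · right
    have h5 : ∀ x, 1 < x → x < 4 → x ∉ A := by
      intro x h1 h4 hx
      have h' := h.2 hx
      simp only [mem_insert] at h'
      rcases h' with h' | h' | h'
      · omega
      · omega
      · have := hX h'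
        simp at this
        omega
    refine ⟨if_pos h, h.2, h.1, ?_, h5 2 (by simp) (by simp), h5 3 (by simp) (by simp)⟩
    by_contra h1
    exact h5 2 (by simp) (by simp) (hA.2 h1).1
  · exact Or.inl ⟨if_neg h, h⟩

lemma complBelow_injOn {n : ℕ} {X : Finset ℕ} (hX : X ⊆ Icc 5 n) :
    Set.InjOn (complBelow n X) (legalSets n) := by
  intro A hA B hB h
  have hne : ∀ A B : Finset ℕ, B ∈ legalSets n → 1 ∈ A → 4 ∈ A → Icc 1 n \ A ≠ B := by
    rintro A B hB h1 h4 rfl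
    have := (hB.2 (by simp [h1])).2.2
    simp [h4] at this
  rcases complBelow_spec hX hA with ⟨ha, -⟩ | ⟨ha, -, ha4, ha1, -⟩ <;>
    rcases complBelow_spec hX hB with ⟨hb, -⟩ | ⟨hb, -, hb4, hb1, -⟩ <;> rw [ha, hb] at h
  · exact h
  · exact absurd h.symm (hne _ _ hA hb1 hb4)
  · exact absurd h (hne _ _ hB ha1 ha4)
  · rw [← Finset.sdiff_sdiff_eq_self hA.1, h, Finset.sdiff_sdiff_eq_self hB.1]

lemma image_complBelow_mem {n s : ℕ} (hn : 5 ≤ n) {X : Finset ℕ} {E : Finset (Finset ℕ)}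
    (hX : X ⊆ Icc 5 n) (hX' : X ≠ Icc 5 n) (hE : IsShifted n X E) (hs : E.card = s)
    (hav : Avoids E X) : E.image (complBelow n X) ∈ interLayerFams n s (star 2) := by
  have hspec := fun A hA => complBelow_spec hX (hE.subset_legalSets (mem_coe.2 hA) : A ∈ _)
  obtain ⟨x, hx, hxX⟩ : ∃ x ∈ Icc 5 n, x ∉ X := by
    by_contra! h
    exact hX' (hX.antisymm h)
  have hx5 := mem_Icc.1 hx
  have hthree : ∀ A, A ⊆ insert 1 (insert 4 X) → 2 ∉ A → 3 ∉ A →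
      ({2, 3, x} : Finset ℕ) ⊆ Icc 1 n \ A := by
    intro A hA h2 h3 y hy
    simp only [mem_insert, mem_singleton] at hy
    have : x ∉ A := fun h => by
      have := hA h
      simp only [mem_insert] at this
      grind
    rw [mem_sdiff, mem_Icc]
    grind
  have hc3 : ({2, 3, x} : Finset ℕ).card = 3 := by
    rw [card_eq_three]
    exact ⟨2, 3, x, by omega, by omega, by omega, rfl⟩
  have hpair' : ∀ A ∈ E, 1 ∈ A → 4 ∉ A → ¬ A ⊆ insert 1 X := by
    intro A hA h1 h4 hsub
    obtain ⟨B, hB, hB1, hd⟩ := hav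
    obtain ⟨y, hy⟩ := hE.inter A hA B hB
    rw [mem_inter] at hy
    rcases mem_insert.1 (hsub hy.1) with rfl | h
    · exact hB1 hy.2
    · exact disjoint_left.1 hd h hy.2
  have hmix : ∀ A ∈ E, ∀ B ∈ E, 1 ∈ A → ¬ (4 ∈ A ∧ A ⊆ insert 1 (insert 4 X)) →
      B ⊆ insert 1 (insert 4 X) → (A ∩ (Icc 1 n \ B)).Nonempty := by
    intro A hA B hB h1 hnot hBX
    rw [nonempty_iff_ne_empty]
    intro h0
    have hsub : A ⊆ B := by
      intro y hy
      by_contra hyB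
      have : y ∈ A ∩ (Icc 1 n \ B) := by simp [hy, hyB, mem_Icc.1 (hE.sub A hA hy)]
      simp [h0] at this
    have h4 : 4 ∉ A := fun h4 => hnot ⟨h4, hsub.trans hBX⟩
    refine hpair' A hA h1 h4 fun y hy => ?_
    have := hBX (hsub hy)
    simp only [mem_insert] at this ⊢
    grind
  have hfix : ∀ t ∈ ({2, 3} : Finset ℕ), complBelow n X {1, t} = {1, t} := by
    intro t ht
    apply if_neg
    simp at ht ⊢
    omega
  apply mem_interLayerFams_star_two
  · rw [card_image_of_injOn ((complBelow_injOn hX).mono hE.subset_legalSets), hs]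
  · simp only [forall_mem_image]
    intro A hA
    rcases hspec A hA with ⟨h, -⟩ | ⟨h, -⟩ <;> rw [h]
    exacts [hE.sub A hA, sdiff_subset]
  · simp only [forall_mem_image]
    intro A hA
    rcases hspec A hA with ⟨h, -⟩ | ⟨h, h', -, -, h2, h3⟩ <;> rw [h]
    · exact hE.two A hA
    · have := card_le_card (hthree A h' h2 h3)
      omega
  · simp only [forall_mem_image]
    intro A hA B hB
    rcases hspec A hA with ⟨ha, hna⟩ | ⟨ha, hsa, ha4, ha1, ha2, ha3⟩ <;>
      rcases hspec B hB with ⟨hb, hnb⟩ | ⟨hb, hsb, hb4, hb1, hb2, hb3⟩ <;> rw [ha, hb]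
    · exact hE.inter A hA B hB
    · by_cases h1 : 1 ∈ A
      · exact hmix A hA B hB h1 hna hsb
      · exact ⟨2, by simp [(hE.tail A hA h1).1, hb2]; omega⟩
    · by_cases h1 : 1 ∈ B
      · rw [inter_comm]
        exact hmix B hB A hA h1 hnb hsa
      · exact ⟨2, by simp [(hE.tail B hB h1).1, ha2]; omega⟩
    · exact ⟨2, by simp [ha2, hb2]; omega⟩
  · exact mem_image.2 ⟨_, hE.mem12, hfix 2 (by simp)⟩
  · exact mem_image.2 ⟨_, hE.mem13, hfix 3 (by simp)⟩
  · simp only [forall_mem_image]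
    intro A hA
    rcases hspec A hA with ⟨h, hn⟩ | ⟨h, h', -, -, h2, h3⟩ <;> rw [h] <;> intro hc
    · rcases hE.pair A hA hc with h | h | rfl
      · exact Or.inl h
      · exact Or.inr h
      · exact absurd ⟨by simp, by intro y; simp only [mem_insert, mem_singleton]; tauto⟩ hn
    · have := card_le_card (hthree A h' h2 h3)
      omega

lemma mem_iff_image_complBelow {n : ℕ} {X : Finset ℕ} {E : Finset (Finset ℕ)}
    (hX : X ⊆ Icc 5 n) (hE : IsShifted n X E) {x : ℕ} :
    x ∈ X ↔ x ∈ Icc 5 n ∧ ∃ B ∈ E.image (complBelow n X), 1 ∉ B ∧ 4 ∉ B ∧ x ∉ B := by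
  constructor
  · intro hx
    refine ⟨hX hx, _, mem_image_of_mem _ hE.memX, ?_⟩
    rw [complBelow, if_pos ⟨by simp, subset_rfl⟩]
    simp [hx]
  · rintro ⟨hx, B, hB, h1, h4, hxB⟩
    obtain ⟨A, hA, rfl⟩ := mem_image.1 hB
    have hx5 := mem_Icc.1 hx
    rcases complBelow_spec hX (hE.subset_legalSets (mem_coe.2 hA)) with
      ⟨h, -⟩ | ⟨h, hs, -⟩ <;> rw [h] at h1 h4 hxB
    · exact absurd (hE.tail A hA h1).2.2 h4
    · have : x ∈ A := by
        by_contra hc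
        exact hxB (by simp [hc]; omega)
      have := hs this
      simp only [mem_insert] at this
      grind

lemma rotateTypes_spec {n : ℕ} (R : Finset ℕ → Prop) (A : Finset ℕ) :
    (rotateTypes n R A = A.erase 4 ∧ 1 ∉ A) ∨
      (rotateTypes n R A = A ∧ 1 ∈ A ∧ (2 ∈ A ∨ 3 ∈ A ∨ ¬ R (A ∩ Icc 5 n))) ∨
      (rotateTypes n R A = insert 4 (Icc 1 n \ A) ∧ 1 ∈ A ∧ 4 ∈ A ∧ 2 ∉ A ∧ 3 ∉ A ∧
        R (A ∩ Icc 5 n)) ∨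
      (rotateTypes n R A = insert 4 A ∧ 1 ∈ A ∧ 4 ∉ A ∧ 2 ∉ A ∧ 3 ∉ A ∧ R (A ∩ Icc 5 n)) := by
  unfold rotateTypes
  split_ifs <;> simp_all; tauto

open Classical in
/-- The inverse of `rotateTypes` on `legalSets`. -/
noncomputable def unrotate (n : ℕ) (R : Finset ℕ → Prop) (C : Finset ℕ) : Finset ℕ :=
  if 1 ∉ C then if 4 ∈ C then insert 4 (Icc 1 n \ C) else insert 4 C
  else if 2 ∈ C ∨ 3 ∈ C then C
  else if R (C ∩ Icc 5 n) then C.erase 4 else C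

lemma unrotate_rotateTypes {n : ℕ} (R : Finset ℕ → Prop) {A : Finset ℕ}
    (hA : A ∈ legalSets n) : unrotate n R (rotateTypes n R A) = A := by
  obtain ⟨hG, ht⟩ := hA
  rcases rotateTypes_spec (n := n) R A with ⟨h, h1⟩ | ⟨h, h1, h2⟩ | ⟨h, h1, h4, h2, h3, hR⟩ |
    ⟨h, h1, h4, h2, h3, hR⟩ <;> rw [h, unrotate]
  · rw [if_pos (by simp [h1]), if_neg (by simp), insert_erase (ht h1).2.2]
  · rw [if_neg (by simp [h1])]
    split_ifs <;> grind
  · rw [if_pos (by simp [h1]), if_pos (by simp)]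
    ext x
    have := @hG x
    simp only [mem_insert, mem_sdiff, mem_Icc] at *
    grind
  · have : insert 4 A ∩ Icc 5 n = A ∩ Icc 5 n := insert_inter_of_notMem (by simp)
    rw [if_neg (by simp [h1]), if_neg (by simp [h2, h3]), this, if_pos hR, erase_insert h4]

lemma rotateTypes_injOn {n : ℕ} (R : Finset ℕ → Prop) :
    Set.InjOn (rotateTypes n R) (legalSets n) := by
  intro A hA B hB h
  rw [← unrotate_rotateTypes R hA, h, unrotate_rotateTypes R hB]

lemma Avoids.mono {E : Finset (Finset ℕ)} {X Y : Finset ℕ} (h : Avoids E X) (hY : Y ⊆ X) :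
    Avoids E Y := by
  obtain ⟨B, hB, h1, hd⟩ := h
  exact ⟨B, hB, h1, hd.mono_left hY⟩

lemma Affected.mono {E : Finset (Finset ℕ)} {X Y Z : Finset ℕ} (h : Affected E X Y)
    (hZ : Z ⊆ Y) : Affected E X Z :=
  h.imp hZ.trans fun h => h.mono hZ

lemma image_rotateTypes_mem {n s : ℕ} (hn : 5 ≤ n) {X : Finset ℕ} {E : Finset (Finset ℕ)}
    (hX : X ⊆ Icc 5 n) (hE : IsShifted n X E) (hs : E.card = s) (hav : ¬ Avoids E X) :
    E.image (rotateTypes n (Affected E X)) ∈ interLayerFams n s (star 2) := by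
  have hspec := rotateTypes_spec (n := n) (Affected E X)
  have hthree : ∀ (B : Finset ℕ) (x y z : ℕ), x < y → y < z → x ∈ B → y ∈ B → z ∈ B →
      3 ≤ B.card := by
    intro B x y z hxy hyz hx hy hz
    have h3 : ({x, y, z} : Finset ℕ).card = 3 :=
      card_eq_three.2 ⟨x, y, z, by omega, by omega, by omega, rfl⟩
    rw [← h3]
    apply card_le_card
    intro w
    simp only [mem_insert, mem_singleton]
    grind
  have hlarge : ∀ A ∈ E, 1 ∉ A → 3 ≤ (A.erase 4).card := by
    intro A hA h1
    obtain ⟨y, hy, hyA⟩ : ∃ y ∈ X, y ∈ A := by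
      by_contra! h
      exact hav ⟨A, hA, h1, disjoint_left.2 h⟩
    have := mem_Icc.1 (hX hy)
    obtain ⟨h2, h3, h4⟩ := hE.tail A hA h1
    exact hthree _ 2 3 y (by omega) (by omega) (by simp [h2]) (by simp [h3])
      (by simp [hyA]; omega)
  have hcross : ∀ A ∈ E, ∀ B ∈ E, 1 ∈ rotateTypes n (Affected E X) A →
      1 ∉ rotateTypes n (Affected E X) B →
      (rotateTypes n (Affected E X) A ∩ rotateTypes n (Affected E X) B).Nonempty := by
    intro A hA B hB h1 h1'
    have h2B : 2 ∈ rotateTypes n (Affected E X) B ∧ 3 ∈ rotateTypes n (Affected E X) B := by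
      rcases hspec B with ⟨h, hB1⟩ | ⟨h, hB1, -⟩ | ⟨h, hB1, hB4, hB2, hB3, hR⟩ | ⟨h, hB1, -⟩ <;>
        rw [h] at h1' ⊢
      · have := hE.tail B hB hB1
        simp [this]
      · exact absurd hB1 h1'
      · simp [hB2, hB3]
        omega
      · simp [hB1] at h1'
    rcases hspec A with ⟨h, hA1⟩ | ⟨h, -, hA⟩ | ⟨h, hA1, -⟩ | ⟨h, -, hA4, hA2, hA3, hR⟩
    · simp [h, hA1] at h1
    · rcases hA with h2 | h3 | hR
      · exact ⟨2, by simp [h2B.1, h, h2]⟩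
      · exact ⟨3, by simp [h2B.2, h, h3]⟩
      · rw [h]
        rcases hspec B with ⟨h', hB1⟩ | ⟨h', hB1, -⟩ | ⟨h', hB1, hB4, hB2, hB3, hR'⟩ |
          ⟨h', hB1, -⟩ <;> rw [h'] at h1' ⊢
        · by_contra! h0
          refine hR (Or.inr ⟨B, hB, hB1, disjoint_left.2 fun y hy hyB => ?_⟩)
          rw [mem_inter, mem_Icc] at hy
          have : y ∈ A ∩ B.erase 4 := by simp [hy, hyB]; omega
          simp [h0] at this
        · exact absurd hB1 h1'
        · by_contra! h0
          refine hR (hR'.mono fun y hy => ?_)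
          rw [mem_inter] at hy ⊢
          refine ⟨?_, hy.2⟩
          by_contra hyB
          have hy5 := mem_Icc.1 hy.2
          have : y ∈ A ∩ insert 4 (Icc 1 n \ B) := by simp [hy, hyB]; omega
          simp [h0] at this
        · simp [hB1] at h1'
    · simp [h, hA1] at h1
    · rw [h]
      rcases hspec B with ⟨h', hB1⟩ | ⟨h', hB1, -⟩ | ⟨h', hB1, hB4, hB2, hB3, hR'⟩ |
          ⟨h', hB1, -⟩ <;> rw [h'] at h1' ⊢
      · obtain ⟨y, hy⟩ := hE.inter A hA B hB
        rw [mem_inter] at hy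
        have : y ≠ 4 := fun h => hA4 (h ▸ hy.1)
        exact ⟨y, by simp [hy, this]⟩
      · exact absurd hB1 h1'
      · exact ⟨4, by simp⟩
      · simp [hB1] at h1'
  have htwo : ∀ A ∈ E, 1 ∉ rotateTypes n (Affected E X) A →
      2 ∈ rotateTypes n (Affected E X) A := by
    intro B hB h1'
    rcases hspec B with ⟨h, hB1⟩ | ⟨h, hB1, -⟩ | ⟨h, hB1, hB4, hB2, hB3, hR⟩ | ⟨h, hB1, -⟩ <;>
      rw [h] at h1' ⊢
    · simp [hE.tail B hB hB1]
    · exact absurd hB1 h1'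
    · simp [hB2]
      omega
    · simp [hB1] at h1'
  have hcompl : ∀ A : Finset ℕ, 2 ∉ A → 3 ∉ A → 3 ≤ (insert 4 (Icc 1 n \ A)).card :=
    fun A h2 h3 => hthree _ 2 3 4 (by simp) (by simp) (by simp [h2]; omega) (by simp [h3]; omega)
      (by simp)
  have hfix : ∀ t ∈ ({2, 3} : Finset ℕ), rotateTypes n (Affected E X) {1, t} = {1, t} := by
    intro t ht
    have ht' : t = 2 ∨ t = 3 := by simpa using ht
    rcases ht' with rfl | rfl <;> simp [rotateTypes]
  apply mem_interLayerFams_star_two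
  · rw [card_image_of_injOn ((rotateTypes_injOn _).mono hE.subset_legalSets), hs]
  · simp only [forall_mem_image]
    intro A hA
    have h4 : 4 ∈ Icc 1 n := by simp; omega
    rcases hspec A with ⟨h, -⟩ | ⟨h, -⟩ | ⟨h, -⟩ | ⟨h, -⟩ <;> rw [h]
    exacts [(erase_subset _ _).trans (hE.sub A hA), hE.sub A hA,
      insert_subset h4 sdiff_subset, insert_subset h4 (hE.sub A hA)]
  · simp only [forall_mem_image]
    intro A hA
    rcases hspec A with ⟨h, h1⟩ | ⟨h, -⟩ | ⟨h, -, -, h2, h3, -⟩ | ⟨h, -⟩ <;> rw [h]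
    · exact (hlarge A hA h1).trans' (by simp)
    · exact hE.two A hA
    · exact (hcompl A h2 h3).trans' (by simp)
    · exact (hE.two A hA).trans (card_le_card (subset_insert _ _))
  · simp only [forall_mem_image]
    intro A hA B hB
    by_cases h1 : 1 ∈ rotateTypes n (Affected E X) A <;>
      by_cases h1' : 1 ∈ rotateTypes n (Affected E X) B
    · exact ⟨1, mem_inter.2 ⟨h1, h1'⟩⟩
    · exact hcross A hA B hB h1 h1'
    · rw [inter_comm]
      exact hcross B hB A hA h1' h1
    · exact ⟨2, mem_inter.2 ⟨htwo A hA h1, htwo B hB h1'⟩⟩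
  · exact mem_image.2 ⟨_, hE.mem12, hfix 2 (by simp)⟩
  · exact mem_image.2 ⟨_, hE.mem13, hfix 3 (by simp)⟩
  · simp only [forall_mem_image]
    intro A hA
    rcases hspec A with ⟨h, h1⟩ | ⟨h, h1, hR⟩ | ⟨h, -, -, h2, h3, -⟩ | ⟨h, -, h4, -⟩ <;> rw [h] <;>
      intro hc
    · have := hlarge A hA h1
      omega
    · rcases hE.pair A hA hc with h | h | rfl
      · exact Or.inl h
      · exact Or.inr h
      · have h0 : ({1, 4} : Finset ℕ) ∩ Icc 5 n = ∅ := by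
          ext y
          simp
        simp [h0, Affected] at hR
    · have := hcompl A h2 h3
      omega
    · rw [card_insert_of_notMem h4] at hc
      have := hE.two A hA
      omega

lemma avoids_iff_image_rotateTypes {n : ℕ} {X Y : Finset ℕ}
    {E : Finset (Finset ℕ)} (hY : Y ⊆ Icc 5 n) :
    Avoids E Y ↔ ∃ B ∈ E.image (rotateTypes n (Affected E X)), 1 ∉ B ∧ 4 ∉ B ∧ Disjoint Y B := by
  constructor
  · rintro ⟨B, hB, h1, hd⟩
    refine ⟨_, mem_image_of_mem _ hB, ?_⟩
    rw [rotateTypes, if_pos h1]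
    exact ⟨by simp [h1], by simp, hd.mono_right (erase_subset _ _)⟩
  · rintro ⟨B, hB, h1, h4, hd⟩
    obtain ⟨A, hA, rfl⟩ := mem_image.1 hB
    rcases rotateTypes_spec (n := n) (Affected E X) A with ⟨h, hA1⟩ | ⟨h, hA1, -⟩ | ⟨h, -⟩ |
      ⟨h, -⟩ <;> rw [h] at h1 h4 hd
    · refine ⟨A, hA, hA1, disjoint_left.2 fun y hy hyA => ?_⟩
      have := mem_Icc.1 (hY hy)
      exact disjoint_left.1 hd hy (mem_erase.2 ⟨by omega, hyA⟩)
    · exact absurd hA1 h1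
    · simp at h4
    · simp at h4

lemma mem_iff_image_rotateTypes {n : ℕ} {X : Finset ℕ} {E : Finset (Finset ℕ)}
    (hX : X ⊆ Icc 5 n) (hE : IsShifted n X E) (hav : ¬ Avoids E X) {x : ℕ} :
    x ∈ X ↔ x ∈ Icc 5 n ∧ ∃ B ∈ E.image (rotateTypes n (Affected E X)),
      1 ∉ B ∧ 4 ∈ B ∧ ¬ Avoids E (Icc 5 n \ B) ∧ x ∉ B := by
  have h2 : ∀ y ∈ X, 5 ≤ y ∧ y ≤ n := fun y hy => mem_Icc.1 (hX hy)
  have htr : ∀ A : Finset ℕ, Icc 5 n \ insert 4 (Icc 1 n \ A) = A ∩ Icc 5 n := by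
    intro A
    ext y
    simp only [mem_sdiff, mem_insert, mem_Icc, mem_inter]
    grind
  have htX : insert 1 (insert 4 X) ∩ Icc 5 n = X := by
    ext y
    simp only [mem_insert, mem_Icc, mem_inter]
    grind
  constructor
  · intro hx
    refine ⟨hX hx, _, mem_image_of_mem _ hE.memX, ?_⟩
    have hrot : rotateTypes n (Affected E X) (insert 1 (insert 4 X)) =
        insert 4 (Icc 1 n \ insert 1 (insert 4 X)) := by
      rw [rotateTypes, if_neg (by simp), if_neg (by simp; grind), htX,
        if_neg (by simp [Affected]), if_pos (by simp)]
    rw [hrot, htr, htX]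
    have := h2 x hx
    refine ⟨by simp, by simp, hav, by simp [hx]; omega⟩
  · rintro ⟨hx, B, hB, h1, h4, hnav, hxB⟩
    obtain ⟨A, hA, rfl⟩ := mem_image.1 hB
    rcases rotateTypes_spec (n := n) (Affected E X) A with ⟨h, hA1⟩ | ⟨h, hA1, -⟩ |
      ⟨h, -, -, -, -, hR⟩ | ⟨h, hA1, -⟩ <;> rw [h] at h1 h4 hnav hxB
    · simp at h4
    · exact absurd hA1 h1
    · rw [htr] at hnav
      refine (hR.resolve_right hnav) (mem_inter.2 ⟨?_, hx⟩)
      have := mem_Icc.1 hx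
      simp at hxB
      apply hxB.2 <;> omega
    · simp [hA1] at h1

lemma avoids_image_shift {X Y : Finset ℕ} {E : Finset (Finset ℕ)} :
    Avoids (E.image (shift X)) Y ↔ Avoids E Y := by
  constructor
  · rintro ⟨B, hB, h1, hd⟩
    obtain ⟨A, hA, rfl⟩ := mem_image.1 hB
    have : shift X (shift X A) = A := by simp [shift]
    rw [shift_apply_of_one_notMem h1] at this
    rw [this] at h1 hd
    exact ⟨A, hA, h1, hd⟩
  · rintro ⟨B, hB, h1, hd⟩
    exact ⟨B, mem_image.2 ⟨B, hB, shift_apply_of_one_notMem h1⟩, h1, hd⟩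

open Classical in
lemma card_filter_avoids_le {n s : ℕ} (hn : 5 ≤ n) :
    ((interLayerFams n s (star 3) ×ˢ ((Icc 5 n).powerset.erase (Icc 5 n))).filter
      fun p => Avoids p.1 p.2).card ≤ (interLayerFams n s (star 2)).card := by
  apply card_le_card_of_injOn fun p => (p.1.image (shift p.2)).image (complBelow n p.2)
  · rintro ⟨E, X⟩ hp
    simp only [coe_filter, mem_product, mem_erase, mem_powerset, Set.mem_ofPred_eq] at hp
    obtain ⟨⟨hE, hX', hX⟩, hav⟩ := hp
    apply image_complBelow_mem hn hX hX' (isShifted_image_shift hn hX hE)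
    · rw [card_image_of_injective _ (Equiv.injective _)]
      exact (mem_powersetCard.1 (mem_filter.1 hE).1).2
    · exact avoids_image_shift.2 hav
  · rintro ⟨E, X⟩ hp ⟨E', X'⟩ hp' h
    simp only [coe_filter, mem_product, mem_erase, mem_powerset, Set.mem_ofPred_eq] at hp hp' h
    have hE := isShifted_image_shift hn hp.1.2.2 hp.1.1
    have hE' := isShifted_image_shift hn hp'.1.2.2 hp'.1.1
    obtain rfl : X = X' := by
      ext x
      rw [mem_iff_image_complBelow hp.1.2.2 hE, h, ← mem_iff_image_complBelow hp'.1.2.2 hE']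
    have := ((complBelow_injOn hp.1.2.2).image_eq_image_iff hE.subset_legalSets
      hE'.subset_legalSets).1 (by exact_mod_cast h)
    rw [image_injective (Equiv.injective _) (coe_injective this)]

open Classical in
lemma card_filter_not_avoids_le {n s : ℕ} (hn : 5 ≤ n) :
    ((interLayerFams n s (star 3) ×ˢ ((Icc 5 n).powerset.erase (Icc 5 n))).filter
      fun p => ¬ Avoids p.1 p.2).card ≤ (interLayerFams n s (star 2)).card := by
  apply card_le_card_of_injOn fun p => (p.1.image (shift p.2)).image
    (rotateTypes n (Affected (p.1.image (shift p.2)) p.2))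
  · rintro ⟨E, X⟩ hp
    simp only [coe_filter, mem_product, mem_erase, mem_powerset, Set.mem_ofPred_eq] at hp
    obtain ⟨⟨hE, hX', hX⟩, hav⟩ := hp
    apply image_rotateTypes_mem hn hX (isShifted_image_shift hn hX hE)
    · rw [card_image_of_injective _ (Equiv.injective _)]
      exact (mem_powersetCard.1 (mem_filter.1 hE).1).2
    · rwa [avoids_image_shift]
  · rintro ⟨E, X⟩ hp ⟨E', X'⟩ hp' h
    simp only [coe_filter, mem_product, mem_erase, mem_powerset, Set.mem_ofPred_eq] at hp hp' h
    have hE := isShifted_image_shift hn hp.1.2.2 hp.1.1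
    have hE' := isShifted_image_shift hn hp'.1.2.2 hp'.1.1
    have hav : ∀ Y ⊆ Icc 5 n, Avoids (E.image (shift X)) Y ↔ Avoids (E'.image (shift X')) Y := by
      intro Y hY
      rw [avoids_iff_image_rotateTypes hY, h, ← avoids_iff_image_rotateTypes hY]
    obtain rfl : X = X' := by
      ext x
      rw [mem_iff_image_rotateTypes hp.1.2.2 hE (by rw [avoids_image_shift]; exact hp.2), h,
        mem_iff_image_rotateTypes hp'.1.2.2 hE' (by rw [avoids_image_shift]; exact hp'.2)]
      simp only [hav _ sdiff_subset]
    have hrot : rotateTypes n (Affected (E.image (shift X)) X) =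
        rotateTypes n (Affected (E'.image (shift X)) X) := by
      ext1 A
      simp only [rotateTypes, Affected, hav _ inter_subset_right]
      congr
    rw [hrot] at h
    have := ((rotateTypes_injOn _).image_eq_image_iff hE.subset_legalSets
      hE'.subset_legalSets).1 (by exact_mod_cast h)
    rw [image_injective (Equiv.injective _) (coe_injective this)]

theorem stmt12 (n s : ℕ) (hn : 21 ≤ n) (hs : 1 ≤ s) :
    (2 ^ (n - 4) - (n - 1)) * (interLayerFams n s (star 3)).card ≤
      2 * (interLayerFams n s (star 2)).card := by
  classical
  have hn5 : 5 ≤ n := by omega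
  have hcard : ((Icc 5 n).powerset.erase (Icc 5 n)).card = 2 ^ (n - 4) - 1 := by
    rw [card_erase_of_mem (by simp), card_powerset, Nat.card_Icc]
    rfl
  have hle := add_le_add (card_filter_avoids_le (s := s) hn5)
    (card_filter_not_avoids_le (s := s) hn5)
  rw [card_filter_add_card_filter_not, card_product, hcard] at hle
  calc _ ≤ (2 ^ (n - 4) - 1) * (interLayerFams n s (_root_.star 3)).card :=
        Nat.mul_le_mul_right _ (by omega)
    _ ≤ _ := by rw [mul_comm, two_mul]; exact hle
end
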